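/- Solvability of the Poisson–Boltzmann equation on the torus. Let d ≥ 1 and let h ∈ L^∞(𝕋^d) with h ≥ 0 almost everywhere and ∫_{𝕋^d} h(x) dx = 1. Then there exists a unique U ∈ H¹(𝕋^d) ∩ L^∞(𝕋^d) solving ΔU = e^U − h weakly, i.e. such that for every φ ∈ C^∞(𝕋^d), −∫_{𝕋^d} ∇U·∇φ dx = ∫_{𝕋^d} (e^U − h) φ dx. -/

import Mathlib

open MeasureTheory Filter Set
open scoped ENNReal Topology

noncomputable section

/-- The flat `d`-dimensional torus `𝕋^d = ℝ^d/ℤ^d`. -/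
abbrev Torus (d : ℕ) := Fin d → AddCircle (1 : ℝ)

/-- The phase space `𝕋^d × ℝ^d`. -/
abbrev Phase (d : ℕ) := Torus d × (Fin d → ℝ)

/-- Canonical projection `ℝ^d → 𝕋^d`. -/
def projT (d : ℕ) (x : Fin d → ℝ) : Torus d := fun i => (x i : AddCircle (1 : ℝ))

/-- The representative in `[0,1)^d` of a point of the torus. -/
def repT (d : ℕ) (y : Torus d) : Fin d → ℝ := fun i => (AddCircle.equivIco 1 0 (y i) : ℝ)

/-- Fundamental domain `[0,1)^d` of the torus. -/
def Cube (d : ℕ) : Set (Fin d → ℝ) := Set.univ.pi fun _ => Set.Ico (0 : ℝ) 1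

/-- `ℤ^d`-periodicity of a function on `ℝ^d` (i.e. the function descends to `𝕋^d`). -/
def ZPeriodic {d : ℕ} {E : Type*} (F : (Fin d → ℝ) → E) : Prop :=
  ∀ (x : Fin d → ℝ) (k : Fin d → ℤ), F (x + fun i => (k i : ℝ)) = F x

/-- The gradient, as the vector of partial derivatives. -/
def gradx {d : ℕ} (g : (Fin d → ℝ) → ℝ) (x : Fin d → ℝ) : Fin d → ℝ :=
  fun i => fderiv ℝ g x (Pi.single i 1)

/-- The Laplacian, as the sum of the second partial derivatives. -/
def lap {d : ℕ} (g : (Fin d → ℝ) → ℝ) (x : Fin d → ℝ) : ℝ :=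
  ∑ i, fderiv ℝ (fun y => fderiv ℝ g y (Pi.single i 1)) x (Pi.single i 1)

/-- The measure on the phase space `𝕋^d × ℝ^d` induced by a (periodic-in-`x`)
density `f(x,v)` on `ℝ^d × ℝ^d`. -/
def measOfDensity (d : ℕ) (f : (Fin d → ℝ) → (Fin d → ℝ) → ℝ) : Measure (Phase d) :=
  Measure.map (fun z : (Fin d → ℝ) × (Fin d → ℝ) => (projT d z.1, z.2))
    ((((volume : Measure (Fin d → ℝ)).restrict (Cube d)).prod
        (volume : Measure (Fin d → ℝ))).withDensity fun z => ENNReal.ofReal (f z.1 z.2))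

/-- Couplings of two measures on the phase space. -/
def couplings (d : ℕ) (μ ν : Measure (Phase d)) : Set (Measure (Phase d × Phase d)) :=
  {π | π.map Prod.fst = μ ∧ π.map Prod.snd = ν}

/-- The Wasserstein distance of order `p` (valued in `ℝ≥0∞`), with respect to the
standard metric on `𝕋^d × ℝ^d`. -/
def Wass (d : ℕ) (p : ℝ) (μ ν : Measure (Phase d)) : ℝ≥0∞ :=
  ⨅ π ∈ couplings d μ ν, (∫⁻ z, edist z.1 z.2 ^ p ∂π) ^ (1 / p)

/-- Periodization of a function on `ℝ^d` over the lattice `ℤ^d`. -/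
def periodize {d : ℕ} (g : (Fin d → ℝ) → ℝ) (x : Fin d → ℝ) : ℝ :=
  ∑' k : Fin d → ℤ, g (x + fun i => (k i : ℝ))

/-- The rescaled charge shape `χ_r(x) = r^{-d} χ(x/r)`. -/
def chiR (d : ℕ) (r : ℝ) (χ : (Fin d → ℝ) → ℝ) (x : Fin d → ℝ) : ℝ :=
  (1 / r ^ d) * χ fun i => x i / r

/-- Hypotheses on the shape `χ` of an extended charge: smooth, compactly supported,
nonnegative, radially symmetric, with unit mass. -/
def IsChargeShape (d : ℕ) (χ : (Fin d → ℝ) → ℝ) : Prop :=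
  ContDiff ℝ (⊤ : ℕ∞) χ ∧ HasCompactSupport χ ∧ (∀ x, 0 ≤ χ x) ∧
    (∀ x y : Fin d → ℝ, (∑ i, x i ^ 2) = (∑ i, y i ^ 2) → χ x = χ y) ∧
    ∫ x, χ x = 1

/-- Time-dependent test functions on `𝕋^d × ℝ^d`: smooth, `ℤ^d`-periodic in `x`,
compactly supported in `v`. -/
def IsTestXV (d : ℕ) (φ : ℝ → (Fin d → ℝ) → (Fin d → ℝ) → ℝ) : Prop :=
  ContDiff ℝ (⊤ : ℕ∞) (fun p : ℝ × (Fin d → ℝ) × (Fin d → ℝ) => φ p.1 p.2.1 p.2.2) ∧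
  (∀ t v, ZPeriodic fun x => φ t x v) ∧
  ∃ R : ℝ, ∀ t x v, R < ‖v‖ → φ t x v = 0

/-- Static test functions on `𝕋^d × ℝ^d`: smooth, `ℤ^d`-periodic in `x`,
compactly supported in `v`. -/
def IsTestXVStatic (d : ℕ) (ψ : (Fin d → ℝ) → (Fin d → ℝ) → ℝ) : Prop :=
  ContDiff ℝ (⊤ : ℕ∞) (fun p : (Fin d → ℝ) × (Fin d → ℝ) => ψ p.1 p.2) ∧
  (∀ v, ZPeriodic fun x => ψ x v) ∧
  ∃ R : ℝ, ∀ x v, R < ‖v‖ → ψ x v = 0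

/-- The integrand of the weak formulation of a Vlasov equation with force field `E`:
`∂_t φ + v · ∇_x φ + E · ∇_v φ`. -/
def vlasovIntegrand (d : ℕ) (E : ℝ → (Fin d → ℝ) → (Fin d → ℝ))
    (φ : ℝ → (Fin d → ℝ) → (Fin d → ℝ) → ℝ) (t : ℝ) (x v : Fin d → ℝ) : ℝ :=
  deriv (fun s => φ s x v) t + fderiv ℝ (fun y => φ t y v) x v
    + fderiv ℝ (fun w => φ t x w) v (E t x)

/-- `U` is a weak solution of the (scaled) Poisson–Boltzmann equation
`ε² ΔU = e^U − h` on the torus, with source `h`. -/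
def IsWeakPB (d : ℕ) (ε : ℝ) (U : (Fin d → ℝ) → ℝ) (h : (Fin d → ℝ) → ℝ) : Prop :=
  ∀ φ : (Fin d → ℝ) → ℝ, ContDiff ℝ (⊤ : ℕ∞) φ → ZPeriodic φ →
    ε ^ 2 * ∫ x in Cube d, U x * lap φ x = ∫ x in Cube d, (Real.exp (U x) - h x) * φ x

/-- `f` is a bounded-density weak solution of the scaled Vlasov–Poisson system with
massless electrons `(VPME)_ε` on the time interval `[0,T)`, with initial datum `f₀`
(`ε = 1` is the unscaled VPME system). -/
structure IsVPMESolOn (d : ℕ) (ε : ℝ) (f₀ : (Fin d → ℝ) → (Fin d → ℝ) → ℝ)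
    (f : ℝ → (Fin d → ℝ) → (Fin d → ℝ) → ℝ) (T : ℝ) : Prop where
  nonneg : ∀ t x v, 0 ≤ f t x v
  periodic : ∀ t v, ZPeriodic fun x => f t x v
  mass : ∀ t ∈ Icc 0 T, ∫ x in Cube d, ∫ v, f t x v = 1
  boundedDensity : ∀ T' ∈ Ico 0 T, ∃ M : ℝ, ∀ t ∈ Icc 0 T', ∀ x, (∫ v, f t x v) ≤ M
  field : ∃ U : ℝ → (Fin d → ℝ) → ℝ,
    (∀ t, ZPeriodic (U t)) ∧ (∀ t, ContDiff ℝ 1 (U t)) ∧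
    (∀ t ∈ Icc 0 T, IsWeakPB d ε (U t) fun x => ∫ v, f t x v) ∧
    (∀ φ : ℝ → (Fin d → ℝ) → (Fin d → ℝ) → ℝ, IsTestXV d φ →
      (∃ b, b < T ∧ ∀ t x v, b ≤ t → φ t x v = 0) →
      (∫ t in Ioi (0 : ℝ), ∫ x in Cube d, ∫ v,
          vlasovIntegrand d (fun t x => -gradx (U t) x) φ t x v * f t x v)
        + (∫ x in Cube d, ∫ v, φ 0 x v * f₀ x v) = 0)

/-- `g` is a measure-valued distributional solution of the kinetic isothermal Euler
system on `[0,T)`, with initial datum `g₀`. -/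
structure IsKIsESolOn (d : ℕ) (g₀ : Measure (Phase d)) (g : ℝ → Measure (Phase d))
    (T : ℝ) : Prop where
  prob : ∀ t ∈ Icc 0 T, IsProbabilityMeasure (g t)
  density : ∃ ρ : ℝ → (Fin d → ℝ) → ℝ,
    (∀ t ∈ Icc 0 T, ZPeriodic (ρ t) ∧ ContDiff ℝ 1 (ρ t) ∧ ∀ x, 0 < ρ t x) ∧
    (∀ t ∈ Icc 0 T, (g t).map Prod.fst =
      (((volume : Measure (Fin d → ℝ)).restrict (Cube d)).withDensity
          fun x => ENNReal.ofReal (ρ t x)).map (projT d)) ∧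
    (∀ φ : ℝ → (Fin d → ℝ) → (Fin d → ℝ) → ℝ, IsTestXV d φ →
      (∃ b, b < T ∧ ∀ t x v, b ≤ t → φ t x v = 0) →
      (∫ t in Ioi (0 : ℝ), ∫ z, vlasovIntegrand d
          (fun t x => -gradx (fun y => Real.log (ρ t y)) x) φ t (repT d z.1) z.2 ∂(g t))
        + (∫ z, φ 0 (repT d z.1) z.2 ∂g₀) = 0)

/-- The extended-ion dynamics: `N` extended charges of shape `χ_r` interacting through
the (scaled) Poisson–Boltzmann coupling with parameter `ε` (`ε = 1` is unscaled). -/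
def IsExtIonSol (d N : ℕ) (ε r : ℝ) (χ : (Fin d → ℝ) → ℝ)
    (X V : ℝ → Fin N → (Fin d → ℝ)) : Prop :=
  ∃ U : ℝ → (Fin d → ℝ) → ℝ,
    (∀ t, ZPeriodic (U t)) ∧ (∀ t, ContDiff ℝ 1 (U t)) ∧
    (∀ t, IsWeakPB d ε (U t)
      fun x => (N : ℝ)⁻¹ * ∑ j, periodize (chiR d r χ) (x - X t j)) ∧
    (∀ t, ∀ i,
      HasDerivAt (fun s => X s i) (V t i) t ∧
      HasDerivAt (fun s => V s i) (-∫ y, chiR d r χ y • gradx (U t) (X t i - y)) t)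

/-- Empirical measure of the `N`-particle configuration at time `t`, as a measure on
the phase space `𝕋^d × ℝ^d`. -/
def empMeas (d N : ℕ) (X V : ℝ → Fin N → (Fin d → ℝ)) (t : ℝ) : Measure (Phase d) :=
  (N : ℝ≥0∞)⁻¹ • ∑ i, Measure.dirac (projT d (X t i), V t i)

/-- The analytic norm `‖h‖_{B_δ} = Σ_k |ĥ(k)| δ^{|k|}` (valued in `ℝ≥0∞`). -/
def Bnorm (d : ℕ) (δ : ℝ) (h : (Fin d → ℝ) → ℝ) : ℝ≥0∞ :=
  ∑' k : Fin d → ℤ,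
    (‖∫ x in Cube d, Complex.exp (-2 * Real.pi * Complex.I * ∑ i, (k i : ℂ) * (x i : ℂ))
        * (h x : ℂ)‖₊ : ℝ≥0∞) * ENNReal.ofReal (δ ^ ∑ i, (k i).natAbs)

/-- The energy of the scaled VPME system:
`½∫|v|²f + (ε²/2)∫|∇U|² + ∫U e^U`. -/
def vpmeEnergy (d : ℕ) (ε : ℝ) (f : (Fin d → ℝ) → (Fin d → ℝ) → ℝ)
    (U : (Fin d → ℝ) → ℝ) : ℝ :=
  (1 / 2) * (∫ x in Cube d, ∫ v, (∑ i, v i ^ 2) * f x v)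
    + (ε ^ 2 / 2) * (∫ x in Cube d, ∑ i, fderiv ℝ U x (Pi.single i 1) ^ 2)
    + ∫ x in Cube d, U x * Real.exp (U x)

/-- `U ∈ H¹(𝕋^d) ∩ L^∞(𝕋^d)`, with weak gradient `V`, is a weak solution of the
Poisson–Boltzmann equation `ΔU = e^U − h`: for every smooth test function `φ` on the
torus, `−∫ ∇U·∇φ = ∫ (e^U − h) φ`. -/
structure IsH1LinfPBSol (d : ℕ) (h : (Fin d → ℝ) → ℝ) (U : (Fin d → ℝ) → ℝ)
    (V : (Fin d → ℝ) → Fin d → ℝ) : Prop where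
  per : ZPeriodic U
  gradPer : ZPeriodic V
  meas : Measurable U
  gradMeas : Measurable V
  -- `U ∈ L^∞(𝕋^d)`
  bdd : ∃ M : ℝ, ∀ᵐ x ∂((volume : Measure (Fin d → ℝ)).restrict (Cube d)), |U x| ≤ M
  -- `U ∈ L²(𝕋^d)` and `∇U ∈ L²(𝕋^d)`, i.e. `U ∈ H¹(𝕋^d)`
  memL2 : MeasureTheory.IntegrableOn (fun x => U x ^ 2) (Cube d)
  gradMemL2 : MeasureTheory.IntegrableOn (fun x => ∑ i, V x i ^ 2) (Cube d)
  -- `V` is the weak gradient of `U`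
  weakGrad : ∀ φ : (Fin d → ℝ) → ℝ, ContDiff ℝ (⊤ : ℕ∞) φ → ZPeriodic φ → ∀ i,
    ∫ x in Cube d, U x * fderiv ℝ φ x (Pi.single i 1) = -∫ x in Cube d, V x i * φ x
  -- weak form of `ΔU = e^U − h`
  weakEq : ∀ φ : (Fin d → ℝ) → ℝ, ContDiff ℝ (⊤ : ℕ∞) φ → ZPeriodic φ →
    -∫ x in Cube d, ∑ i, V x i * fderiv ℝ φ x (Pi.single i 1)
      = ∫ x in Cube d, (Real.exp (U x) - h x) * φ x

open scoped ComplexConjugate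

/-- The Haar probability measure on the torus `𝕋^d`. -/
def torusHaar (d : ℕ) : Measure (Torus d) :=
  Measure.pi fun _ => (AddCircle.haarAddCircle : Measure (AddCircle (1 : ℝ)))

instance (d : ℕ) : IsProbabilityMeasure (torusHaar d) :=
  inferInstanceAs (IsProbabilityMeasure (Measure.pi _))

instance (d : ℕ) : (torusHaar d).IsAddLeftInvariant :=
  inferInstanceAs (Measure.IsAddLeftInvariant (Measure.pi _))

/-- The Fourier coefficients of a complex-valued function on the torus. -/
def torusCoeff {d : ℕ} (f : Torus d → ℂ) (k : Fin d → ℤ) : ℂ :=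
  ∫ x, conj (UnitAddTorus.mFourier k x) * f x ∂torusHaar d

lemma torusCoeff_congr_ae {d : ℕ} {f g : Torus d → ℂ} (hfg : f =ᵐ[torusHaar d] g) :
    torusCoeff f = torusCoeff g := by
  funext k
  refine integral_congr_ae ?_
  filter_upwards [hfg] with x hx
  rw [hx]

lemma mFourierBasis_repr_eq_torusCoeff {d : ℕ} (f : Lp ℂ 2 (torusHaar d)) (k : Fin d → ℤ) :
    (UnitAddTorus.mFourierBasis (d := Fin d)).repr f k = torusCoeff f k := by
  refine (UnitAddTorus.mFourierBasis_repr f k).trans ?_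
  simp only [UnitAddTorus.mFourierCoeff, UnitAddTorus.mFourier_neg, smul_eq_mul]
  rfl

/-- **Parseval's identity** on the torus. -/
lemma hasSum_conj_torusCoeff_mul {d : ℕ} {f g : Torus d → ℂ} (hf : MemLp f 2 (torusHaar d))
    (hg : MemLp g 2 (torusHaar d)) :
    HasSum (fun k => conj (torusCoeff f k) * torusCoeff g k)
      (∫ x, conj (f x) * g x ∂torusHaar d) := by
  have h1 := (UnitAddTorus.mFourierBasis (d := Fin d)).hasSum_inner_mul_inner
    (hf.toLp f) (hg.toLp g)
  have h2 : inner ℂ (hf.toLp f) (hg.toLp g) = ∫ x, conj (f x) * g x ∂torusHaar d := by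
    refine (L2.inner_def (𝕜 := ℂ) (μ := torusHaar d) (hf.toLp f) (hg.toLp g)).trans ?_
    refine integral_congr_ae ?_
    filter_upwards [hf.coeFn_toLp, hg.coeFn_toLp] with x h1 h2
    rw [h1, h2, RCLike.inner_apply, mul_comm]
  rw [← h2]
  refine h1.congr_fun fun k => ?_
  have h3 : ∀ F : Lp ℂ 2 (torusHaar d), torusCoeff F k = inner ℂ (UnitAddTorus.mFourierBasis k) F :=
    fun F => (mFourierBasis_repr_eq_torusCoeff F k).symm.trans
      (HilbertBasis.repr_apply_apply _ _ _)
  rw [← torusCoeff_congr_ae hf.coeFn_toLp, ← torusCoeff_congr_ae hg.coeFn_toLp, h3, h3]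
  exact congrArg₂ _ (inner_conj_symm _ _) rfl

lemma summable_sq_norm_torusCoeff {d : ℕ} {f : Torus d → ℂ} (hf : MemLp f 2 (torusHaar d)) :
    Summable fun k => ‖torusCoeff f k‖ ^ 2 := by
  have := (hasSum_conj_torusCoeff_mul hf hf).summable.norm
  refine this.congr fun k => ?_
  rw [norm_mul, RCLike.norm_conj, sq]

/-- **Riesz–Fischer** on the torus. -/
lemma exists_torusCoeff_eq {d : ℕ} (a : (Fin d → ℤ) → ℂ) (ha : Summable fun k => ‖a k‖ ^ 2) :
    ∃ g : Torus d → ℂ, Measurable g ∧ MemLp g 2 (torusHaar d) ∧ ∀ k, torusCoeff g k = a k := by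
  have hmem : Memℓp a 2 := by
    refine memℓp_gen ?_
    simpa using ha
  let G : Lp ℂ 2 (torusHaar d) :=
    (UnitAddTorus.mFourierBasis (d := Fin d)).repr.symm ⟨a, hmem⟩
  have hG := Lp.memLp G
  refine ⟨hG.1.mk G, hG.1.stronglyMeasurable_mk.measurable, hG.ae_eq hG.1.ae_eq_mk, fun k => ?_⟩
  rw [← torusCoeff_congr_ae hG.1.ae_eq_mk, ← mFourierBasis_repr_eq_torusCoeff]
  simp only [G, LinearIsometryEquiv.apply_symm_apply]

lemma measurePreserving_projT (d : ℕ) :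
    MeasurePreserving (projT d) ((volume : Measure (Fin d → ℝ)).restrict (Cube d))
      (torusHaar d) := by
  have h1 : (volume : Measure (Fin d → ℝ)).restrict (Cube d)
      = Measure.pi fun _ => (volume : Measure ℝ).restrict (Ico 0 1) := by
    rw [Cube, volume_pi, Measure.restrict_pi_pi]
  rw [h1]
  refine measurePreserving_pi _ _ fun i => ?_
  have h2 := AddCircle.measurePreserving_mk (1 : ℝ) 0
  rw [zero_add, AddCircle.volume_eq_smul_haarAddCircle, ENNReal.ofReal_one, one_smul,
    ← restrict_Ico_eq_restrict_Ioc] at h2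
  exact h2

lemma Measure.smul_pi_le_pi {ι : Type*} [Fintype ι] {α : ι → Type*}
    [∀ i, MeasurableSpace (α i)] (μ ν : ∀ i, Measure (α i)) [∀ i, SigmaFinite (μ i)]
    [∀ i, SigmaFinite (ν i)] (c : ι → ℝ≥0∞) (hc : ∀ i, c i • μ i ≤ ν i) :
    (∏ i, c i) • Measure.pi μ ≤ Measure.pi ν := by
  have h1 : ((∏ i, c i) • Measure.pi μ).toOuterMeasure ≤
      OuterMeasure.pi fun i => (ν i).toOuterMeasure := by
    rw [OuterMeasure.le_pi]
    intro s _
    simp only [Measure.toOuterMeasure_apply, Measure.smul_apply, smul_eq_mul, Measure.pi_pi]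
    rw [← Finset.prod_mul_distrib]
    exact Finset.prod_le_prod' fun i _ => hc i (s i)
  rw [Measure.le_iff]
  intro s hs
  have h2 : Measure.pi ν s = OuterMeasure.pi (fun i => (ν i).toOuterMeasure) s := by
    rw [Measure.pi, toMeasure_apply _ _ hs]
  rw [h2]
  exact h1 s

/-- The projection to the circle of a centred Gaussian whose variance lies in `[2, 4]` dominates
a fixed multiple of the Haar measure. -/
lemma smul_haarAddCircle_le_map_gaussianReal {v : NNReal} (h2 : 2 ≤ v) (h4 : v ≤ 4) :
    ENNReal.ofReal ((√(2 * Real.pi * 4))⁻¹ * Real.exp (-(1 / 4))) •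
        (AddCircle.haarAddCircle : Measure (AddCircle (1 : ℝ)))
      ≤ (ProbabilityTheory.gaussianReal 0 v).map (fun x : ℝ => (x : AddCircle (1 : ℝ))) := by
  have hmk := AddCircle.measurePreserving_mk (1 : ℝ) 0
  rw [zero_add, AddCircle.volume_eq_smul_haarAddCircle, ENNReal.ofReal_one, one_smul] at hmk
  rw [← hmk.map_eq, ← Measure.map_smul]
  refine Measure.map_mono ?_ hmk.measurable
  have hv : v ≠ 0 := by
    rintro rfl
    exact absurd h2 (by norm_num)
  have hv2 : (2 : ℝ) ≤ v := by exact_mod_cast h2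
  have hv4 : (v : ℝ) ≤ 4 := by exact_mod_cast h4
  rw [ProbabilityTheory.gaussianReal_of_var_ne_zero _ hv, ← withDensity_const,
    ← withDensity_indicator measurableSet_Ioc]
  refine withDensity_mono (ae_of_all _ fun x => ?_)
  by_cases hx : x ∈ Ioc (0 : ℝ) 1
  · rw [indicator_of_mem hx, ProbabilityTheory.gaussianPDF, ProbabilityTheory.gaussianPDFReal]
    refine ENNReal.ofReal_le_ofReal ?_
    have hpi := Real.pi_pos
    gcongr
    rw [sub_zero, neg_div, neg_le_neg_iff, div_le_div_iff₀ (by positivity) (by norm_num)]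
    nlinarith [hx.1, hx.2]
  · rw [indicator_of_notMem hx]
    exact zero_le

/-- The law at an exponential time of the Brownian motion on the torus: its convolution operator
is the (normalized) resolvent of the Laplacian. -/
def resolventMeasure (d : ℕ) (l : ℝ) : Measure (Torus d) :=
  ((ProbabilityTheory.expMeasure l).prod
    (Measure.pi fun _ : Fin d => ProbabilityTheory.gaussianReal 0 1)).map
      fun p => projT d fun i => √(2 * p.1) * p.2 i

lemma measurable_projT (d : ℕ) : Measurable (projT d) := (measurePreserving_projT d).measurable

lemma measurable_resolvent_map (d : ℕ) :
    Measurable fun p : ℝ × (Fin d → ℝ) => projT d fun i => √(2 * p.1) * p.2 i :=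
  (measurable_projT d).comp (by fun_prop)

lemma isProbabilityMeasure_resolventMeasure (d : ℕ) {l : ℝ} (hl : 0 < l) :
    IsProbabilityMeasure (resolventMeasure d l) := by
  have := ProbabilityTheory.isProbabilityMeasure_expMeasure hl
  exact Measure.isProbabilityMeasure_map (measurable_resolvent_map d).aemeasurable

lemma integral_exp_neg_mul_expMeasure {l : ℝ} (hl : 0 < l) {a : ℝ} (ha : 0 ≤ a) :
    ∫ t, Real.exp (-(a * t)) ∂ProbabilityTheory.expMeasure l = l / (l + a) := by
  have h1 : ProbabilityTheory.expMeasure l =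
      volume.withDensity (ProbabilityTheory.exponentialPDF l) := rfl
  rw [h1, integral_withDensity_eq_integral_toReal_smul₀]
  · have h2 : ∀ t, (ProbabilityTheory.exponentialPDF l t).toReal • Real.exp (-(a * t))
        = (Ici (0 : ℝ)).indicator (fun t => l * Real.exp (-(l + a) * t)) t := by
      intro t
      by_cases ht : 0 ≤ t
      · rw [ProbabilityTheory.exponentialPDF_of_nonneg ht, indicator_of_mem (mem_Ici.2 ht),
          ENNReal.toReal_ofReal (by positivity), smul_eq_mul, mul_assoc, ← Real.exp_add]
        ring_nf
      · rw [ProbabilityTheory.exponentialPDF_of_neg (not_le.1 ht), indicator_of_notMem (by simpa using ht)]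
        simp
    simp_rw [h2]
    rw [integral_indicator measurableSet_Ici, integral_Ici_eq_integral_Ioi, integral_const_mul,
      integral_exp_mul_Ioi (by linarith)]
    have hla : l + a ≠ 0 := by positivity
    rw [mul_zero, Real.exp_zero, div_neg, neg_div, neg_neg, mul_one_div]
  · exact (ProbabilityTheory.measurable_exponentialPDFReal l).ennreal_ofReal.aemeasurable
  · exact ae_of_all _ fun t => ENNReal.ofReal_lt_top

lemma integral_mFourier_projT_gaussian (d : ℕ) (k : Fin d → ℤ) {t : ℝ} (ht : 0 ≤ t) :
    ∫ z, UnitAddTorus.mFourier k (projT d fun i => √(2 * t) * z i)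
        ∂(Measure.pi fun _ : Fin d => ProbabilityTheory.gaussianReal 0 1)
      = (Real.exp (-((4 * Real.pi ^ 2 * ∑ i, (k i : ℝ) ^ 2) * t)) : ℝ) := by
  have h1 : ∀ z : Fin d → ℝ, UnitAddTorus.mFourier k (projT d fun i => √(2 * t) * z i)
      = ∏ i, Complex.exp (((2 * Real.pi * k i * √(2 * t) : ℝ) : ℂ) * (z i : ℂ) * Complex.I) := by
    intro z
    simp only [UnitAddTorus.mFourier, projT, ContinuousMap.coe_mk, fourier_coe_apply]
    refine Finset.prod_congr rfl fun i _ => ?_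
    congr 1
    push_cast
    ring
  simp_rw [h1]
  rw [integral_fintype_prod_eq_prod (𝕜 := ℂ)
    (f := fun i (x : ℝ) => Complex.exp (((2 * Real.pi * k i * √(2 * t) : ℝ) : ℂ) * (x : ℂ) * Complex.I))]
  simp_rw [← charFun_apply_real, ProbabilityTheory.charFun_gaussianReal]
  rw [← Complex.exp_sum, Complex.ofReal_exp]
  congr 1
  push_cast
  rw [Finset.mul_sum, Finset.sum_mul, ← Finset.sum_neg_distrib]
  refine Finset.sum_congr rfl fun i _ => ?_
  have h2 : ((√(2 * t) : ℝ) : ℂ) ^ 2 = 2 * t := by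
    rw [← Complex.ofReal_pow, Real.sq_sqrt (by positivity)]
    push_cast
    ring
  simp only [mul_pow, h2]
  simp
  ring

lemma integral_mFourier_resolventMeasure (d : ℕ) {l : ℝ} (hl : 0 < l) (k : Fin d → ℤ) :
    ∫ x, UnitAddTorus.mFourier k x ∂resolventMeasure d l
      = (l / (l + 4 * Real.pi ^ 2 * ∑ i, (k i : ℝ) ^ 2) : ℝ) := by
  have := ProbabilityTheory.isProbabilityMeasure_expMeasure hl
  have hc := (UnitAddTorus.mFourier k).continuous
  rw [resolventMeasure, integral_map (measurable_resolvent_map d).aemeasurable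
    hc.aestronglyMeasurable, integral_prod]
  · rw [← integral_exp_neg_mul_expMeasure hl (by positivity), ← integral_complex_ofReal]
    refine integral_congr_ae ?_
    have h0 : ∀ᵐ t ∂ProbabilityTheory.expMeasure l, 0 ≤ t := by
      have h1 : ProbabilityTheory.expMeasure l =
        volume.withDensity (ProbabilityTheory.exponentialPDF l) := rfl
      have h2 : Measurable (ProbabilityTheory.exponentialPDF l) :=
        (ProbabilityTheory.measurable_exponentialPDFReal l).ennreal_ofReal
      rw [h1, ae_withDensity_iff h2]
      refine ae_of_all _ fun t ht => ?_
      by_contra h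
      exact ht (ProbabilityTheory.exponentialPDF_of_neg (not_le.1 h))
    filter_upwards [h0] with t ht
    rw [integral_mFourier_projT_gaussian d k ht]
  · refine Integrable.of_bound (hc.measurable.comp
      (measurable_resolvent_map d)).aestronglyMeasurable 1 (ae_of_all _ fun p => ?_)
    exact ((UnitAddTorus.mFourier k).norm_coe_le_norm _).trans_eq UnitAddTorus.mFourier_norm

lemma exists_smul_torusHaar_le_resolventMeasure (d : ℕ) {l : ℝ} (hl : 0 < l) :
    ∃ c : ℝ, 0 < c ∧ ENNReal.ofReal c • torusHaar d ≤ resolventMeasure d l := by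
  have := ProbabilityTheory.isProbabilityMeasure_expMeasure hl
  set δ : ℝ := (√(2 * Real.pi * 4))⁻¹ * Real.exp (-(1 / 4)) with hδ
  have hδ0 : 0 < δ := by positivity
  have h1 : ProbabilityTheory.expMeasure l =
      volume.withDensity (ProbabilityTheory.exponentialPDF l) := rfl
  have hm : ENNReal.ofReal (l * Real.exp (-(l * 2))) ≤
      ProbabilityTheory.expMeasure l (Icc 1 2) := by
    rw [h1, withDensity_apply _ measurableSet_Icc]
    calc ENNReal.ofReal (l * Real.exp (-(l * 2)))
        = ∫⁻ t in Icc (1 : ℝ) 2, ENNReal.ofReal (l * Real.exp (-(l * 2))) := by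
          rw [setLIntegral_const, Real.volume_Icc]
          norm_num
      _ ≤ _ := by
          refine setLIntegral_mono' measurableSet_Icc fun t ht => ?_
          rw [ProbabilityTheory.exponentialPDF_of_nonneg (by linarith [ht.1])]
          refine ENNReal.ofReal_le_ofReal ?_
          gcongr
          exact ht.2
  have ht : ∀ t ∈ Icc (1 : ℝ) 2, ENNReal.ofReal (δ ^ d) • torusHaar d ≤
      (Measure.pi fun _ : Fin d => ProbabilityTheory.gaussianReal 0 1).map
        fun z => projT d fun i => √(2 * t) * z i := by
    intro t ht
    have ht0 : 0 ≤ 2 * t := by linarith [ht.1]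
    obtain ⟨v, hv⟩ : ∃ v : NNReal, (v : ℝ) = 2 * t := ⟨NNReal.mk (2 * t) ht0, rfl⟩
    have hmeas : Measurable fun x : ℝ => ((√(2 * t) * x : ℝ) : AddCircle (1 : ℝ)) :=
      (AddCircle.measurePreserving_mk (1 : ℝ) 0).measurable.comp (by fun_prop)
    have h2 : (Measure.pi fun _ : Fin d => ProbabilityTheory.gaussianReal 0 1).map
        (fun z => projT d fun i => √(2 * t) * z i) =
        Measure.pi fun _ : Fin d => (ProbabilityTheory.gaussianReal 0 1).map
          fun x : ℝ => ((√(2 * t) * x : ℝ) : AddCircle (1 : ℝ)) := by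
      have : ∀ i : Fin d, IsProbabilityMeasure ((ProbabilityTheory.gaussianReal 0 1).map
          fun x : ℝ => ((√(2 * t) * x : ℝ) : AddCircle (1 : ℝ))) :=
        fun i => Measure.isProbabilityMeasure_map hmeas.aemeasurable
      exact Measure.pi_map_pi fun i => hmeas.aemeasurable
    have h3 : (ProbabilityTheory.gaussianReal 0 1).map
        (fun x : ℝ => ((√(2 * t) * x : ℝ) : AddCircle (1 : ℝ))) =
        (ProbabilityTheory.gaussianReal 0 v).map
          (fun x : ℝ => (x : AddCircle (1 : ℝ))) := by
      have h4 := ProbabilityTheory.gaussianReal_map_const_mul (μ := 0) (v := 1) (√(2 * t))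
      have h5 : NNReal.mk (√(2 * t) ^ 2) (sq_nonneg _) * 1 = v := by
        rw [mul_one]
        exact NNReal.eq ((Real.sq_sqrt ht0).trans hv.symm)
      rw [mul_zero, h5] at h4
      rw [← h4, Measure.map_map (AddCircle.measurePreserving_mk (1 : ℝ) 0).measurable (by fun_prop)]
      rfl
    have := Measure.isProbabilityMeasure_map (μ := ProbabilityTheory.gaussianReal 0 v)
      (AddCircle.measurePreserving_mk (1 : ℝ) 0).measurable.aemeasurable
    rw [h2, h3, torusHaar]
    have h6 := Measure.smul_pi_le_pi (ι := Fin d) (fun _ => AddCircle.haarAddCircle (T := (1 : ℝ)))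
      (fun _ => (ProbabilityTheory.gaussianReal 0 v).map
          (fun x : ℝ => (x : AddCircle (1 : ℝ)))) (fun _ => ENNReal.ofReal δ) fun _ =>
        smul_haarAddCircle_le_map_gaussianReal (v := v)
          (by rw [← NNReal.coe_le_coe]; rw [hv]; push_cast; linarith [ht.1])
          (by rw [← NNReal.coe_le_coe]; rw [hv]; push_cast; linarith [ht.2])
    rwa [Finset.prod_const, Finset.card_univ, Fintype.card_fin, ← ENNReal.ofReal_pow hδ0.le] at h6
  refine ⟨δ ^ d * (l * Real.exp (-(l * 2))), by positivity, ?_⟩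
  rw [Measure.le_iff]
  intro s hs
  have hpre := (measurable_resolvent_map d) hs
  rw [resolventMeasure, Measure.map_apply (measurable_resolvent_map d) hs,
    Measure.prod_apply hpre]
  calc (ENNReal.ofReal (δ ^ d * (l * Real.exp (-(l * 2)))) • torusHaar d) s
      = (ENNReal.ofReal (δ ^ d) * torusHaar d s) * ENNReal.ofReal (l * Real.exp (-(l * 2))) := by
        rw [Measure.smul_apply, smul_eq_mul, ENNReal.ofReal_mul (by positivity)]
        ring
    _ ≤ (ENNReal.ofReal (δ ^ d) * torusHaar d s) * ProbabilityTheory.expMeasure l (Icc 1 2) := by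
        gcongr
    _ = ∫⁻ t in Icc (1 : ℝ) 2, ENNReal.ofReal (δ ^ d) * torusHaar d s
          ∂ProbabilityTheory.expMeasure l := by rw [setLIntegral_const]
    _ ≤ ∫⁻ t in Icc (1 : ℝ) 2, (Measure.pi fun _ : Fin d => ProbabilityTheory.gaussianReal 0 1)
          (Prod.mk t ⁻¹' ((fun p : ℝ × (Fin d → ℝ) => projT d fun i => √(2 * p.1) * p.2 i) ⁻¹' s))
          ∂ProbabilityTheory.expMeasure l := by
        refine setLIntegral_mono' measurableSet_Icc fun t htI => ?_
        have h := ht t htI s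
        have hmeas : Measurable fun z : Fin d → ℝ => projT d fun i => √(2 * t) * z i :=
          (measurable_projT d).comp (by fun_prop)
        rwa [Measure.smul_apply, smul_eq_mul, Measure.map_apply hmeas hs] at h
    _ ≤ _ := setLIntegral_le_lintegral _ _

lemma mFourier_apply_add {d : ℕ} (k : Fin d → ℤ) (x y : Torus d) :
    UnitAddTorus.mFourier k (x + y) = UnitAddTorus.mFourier k x * UnitAddTorus.mFourier k y := by
  simp only [UnitAddTorus.mFourier, ContinuousMap.coe_mk, Pi.add_apply, fourier_apply, smul_add,
    AddCircle.toCircle_add, Circle.coe_mul, Finset.prod_mul_distrib]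

lemma conj_mFourier_mul_self {d : ℕ} (k : Fin d → ℤ) (x : Torus d) :
    conj (UnitAddTorus.mFourier k x) * UnitAddTorus.mFourier k x = 1 := by
  rw [← UnitAddTorus.mFourier_neg, ← UnitAddTorus.mFourier_add, neg_add_cancel,
    UnitAddTorus.mFourier_zero, ContinuousMap.one_apply]

lemma norm_mFourier_apply {d : ℕ} (k : Fin d → ℤ) (x : Torus d) :
    ‖UnitAddTorus.mFourier k x‖ = 1 := by
  have h1 := congrArg norm (conj_mFourier_mul_self k x)
  rw [norm_mul, RCLike.norm_conj, norm_one] at h1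
  nlinarith [norm_nonneg (UnitAddTorus.mFourier k x)]

lemma torusCoeff_integral_add {d : ℕ} (m : Measure (Torus d)) [IsProbabilityMeasure m]
    {g : Torus d → ℂ} (hg : Measurable g) {B : ℝ} (hB : ∀ x, ‖g x‖ ≤ B) (k : Fin d → ℤ) :
    torusCoeff (fun x => ∫ z, g (x + z) ∂m) k =
      (∫ z, UnitAddTorus.mFourier k z ∂m) * torusCoeff g k := by
  have hc : Measurable fun x : Torus d => conj (UnitAddTorus.mFourier k x) :=
    (Complex.continuous_conj.comp (UnitAddTorus.mFourier k).continuous).measurable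
  have hint : Integrable (Function.uncurry fun x z : Torus d =>
      conj (UnitAddTorus.mFourier k x) * g (x + z)) ((torusHaar d).prod m) := by
    refine Integrable.of_bound (C := B) (((hc.comp measurable_fst).mul
      (hg.comp (measurable_fst.add measurable_snd))).aestronglyMeasurable)
      (ae_of_all _ fun p => ?_)
    simp only [Function.uncurry]
    rw [norm_mul, RCLike.norm_conj, norm_mFourier_apply, one_mul]
    exact hB _
  have h1 : torusCoeff (fun x => ∫ z, g (x + z) ∂m) k =
      ∫ x, ∫ z, conj (UnitAddTorus.mFourier k x) * g (x + z) ∂m ∂torusHaar d :=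
    integral_congr_ae (ae_of_all _ fun x => (integral_const_mul _ _).symm)
  rw [h1, integral_integral_swap hint, ← integral_mul_const]
  refine integral_congr_ae (ae_of_all _ fun z => ?_)
  simp only
  rw [torusCoeff, ← integral_add_right_eq_self (μ := torusHaar d)
    (fun x => conj (UnitAddTorus.mFourier k x) * g x) z, ← integral_const_mul]
  refine integral_congr_ae (ae_of_all _ fun x => ?_)
  simp only [mFourier_apply_add, map_mul]
  linear_combination (-(conj (UnitAddTorus.mFourier k x)) * g (x + z)) *
    conj_mFourier_mul_self k z

lemma integral_le_integral_of_smul_le {d : ℕ} {m : Measure (Torus d)} [IsProbabilityMeasure m]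
    {c : ℝ} (hc : 0 < c) (hm : ENNReal.ofReal c • torusHaar d ≤ m) {h : Torus d → ℝ}
    (hmeas : Measurable h) {M : ℝ} (h0 : ∀ x, 0 ≤ h x) (hM : ∀ x, h x ≤ M) (x : Torus d) :
    c * ∫ y, h y ∂torusHaar d ≤ ∫ z, h (x + z) ∂m := by
  have hint : Integrable (fun z => h (x + z)) m := by
    refine Integrable.of_bound (C := M)
      (hmeas.comp (measurable_const.add measurable_id)).aestronglyMeasurable (ae_of_all _ fun z => ?_)
    rw [Real.norm_of_nonneg (h0 _)]
    exact hM _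
  have h1 := integral_mono_measure hm (ae_of_all _ fun z => h0 (x + z)) hint
  rw [integral_smul_measure, integral_add_left_eq_self (μ := torusHaar d) h x,
    ENNReal.toReal_ofReal hc.le] at h1
  exact h1

lemma exp_sub_exp_le_mul {s t l : ℝ} (hst : s ≤ t) (htl : Real.exp t ≤ l) :
    Real.exp t - Real.exp s ≤ l * (t - s) := by
  have h1 : Real.exp s = Real.exp t * Real.exp (s - t) := by
    rw [← Real.exp_add]
    ring_nf
  have h2 := Real.add_one_le_exp (s - t)
  have h3 := Real.exp_pos t
  nlinarith

/-- A bounded solution of the Poisson–Boltzmann equation in resolvent form, obtained by monotone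
iteration. -/
lemma exists_bounded_resolvent_solution {d : ℕ} (m : Measure (Torus d)) [IsProbabilityMeasure m]
    {c l : ℝ} (hc : 0 < c) (hl : 0 < l) (hm : ENNReal.ofReal c • torusHaar d ≤ m)
    {h : Torus d → ℝ} (hmeas : Measurable h) (h0 : ∀ x, 0 ≤ h x) (hl' : ∀ x, h x ≤ l)
    (hmass : ∫ x, h x ∂torusHaar d = 1) :
    ∃ u : Torus d → ℝ, Measurable u ∧ (∃ A, ∀ x, |u x| ≤ A) ∧
      ∀ x, u x = ∫ z, (u (x + z) + (h (x + z) - Real.exp (u (x + z))) / l) ∂m := by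
  set b : ℝ := Real.log l with hb
  set a : ℝ := min (Real.log c) b with ha
  have heb : Real.exp b = l := Real.exp_log hl
  have hea : Real.exp a ≤ c := by
    rw [← Real.exp_log hc]
    exact Real.exp_le_exp.2 (min_le_left _ _)
  have hab : a ≤ b := min_le_right _ _
  have hPhi : ∀ y s t : ℝ, s ≤ t → t ≤ b → s + (y - Real.exp s) / l ≤ t + (y - Real.exp t) / l := by
    intro y s t hst htb
    have h1 := exp_sub_exp_le_mul hst ((Real.exp_le_exp.2 htb).trans_eq heb)
    have h2 : (Real.exp t - Real.exp s) / l ≤ t - s := by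
      rw [div_le_iff₀ hl]
      linarith
    have h3 : (y - Real.exp s) / l - (y - Real.exp t) / l = (Real.exp t - Real.exp s) / l := by ring
    linarith
  have hPhib : ∀ y ∈ Icc 0 l, ∀ s ∈ Icc a b, s + (y - Real.exp s) / l ≤ b := by
    intro y hy s hs
    refine (hPhi y s b hs.2 le_rfl).trans ?_
    rw [heb]
    have : (y - l) / l ≤ 0 := div_nonpos_of_nonpos_of_nonneg (by linarith [hy.2]) hl.le
    linarith
  have hPhia : ∀ y ∈ Icc 0 l, ∀ s ∈ Icc a b, a - c / l ≤ s + (y - Real.exp s) / l := by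
    intro y hy s hs
    refine le_trans ?_ (hPhi y a s hs.1 hs.2)
    have : -(c / l) ≤ (y - Real.exp a) / l := by
      rw [← neg_div]
      gcongr
      linarith [hy.1]
    linarith
  set B : ℝ := max |a - c / l| |b| with hB
  have hbound : ∀ y ∈ Icc 0 l, ∀ s ∈ Icc a b, ‖s + (y - Real.exp s) / l‖ ≤ B := fun y hy s hs =>
    abs_le_max_abs_abs (hPhia y hy s hs) (hPhib y hy s hs)
  have hh : ∀ x, h x ∈ Icc 0 l := fun x => ⟨h0 x, hl' x⟩
  have hmeasPhi : ∀ u : Torus d → ℝ, Measurable u →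
      Measurable fun x => u x + (h x - Real.exp (u x)) / l := fun u hu => by fun_prop
  have hint : ∀ u : Torus d → ℝ, Measurable u → (∀ x, u x ∈ Icc a b) → ∀ x,
      Integrable (fun z => u (x + z) + (h (x + z) - Real.exp (u (x + z))) / l) m :=
    fun u hu hub x => Integrable.of_bound ((hmeasPhi u hu).comp
      (measurable_const.add measurable_id)).aestronglyMeasurable B
      (ae_of_all _ fun z => hbound _ (hh _) _ (hub _))
  let T : (Torus d → ℝ) → Torus d → ℝ :=
    fun u x => ∫ z, (u (x + z) + (h (x + z) - Real.exp (u (x + z))) / l) ∂m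
  have hTmeas : ∀ u : Torus d → ℝ, Measurable u → Measurable (T u) := by
    intro u hu
    have h1 : StronglyMeasurable (Function.uncurry fun x z : Torus d =>
        u (x + z) + (h (x + z) - Real.exp (u (x + z))) / l) :=
      ((hmeasPhi u hu).comp (measurable_fst.add measurable_snd)).stronglyMeasurable
    exact h1.integral_prod_right.measurable
  have hTmono : ∀ u v : Torus d → ℝ, Measurable u → Measurable v → (∀ x, u x ∈ Icc a b) →
      (∀ x, v x ∈ Icc a b) → u ≤ v → T u ≤ T v := fun u v hu hv hub hvb huv x =>
    integral_mono (hint u hu hub x) (hint v hv hvb x) fun z => hPhi _ _ _ (huv _) (hvb _).2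
  have hTa : ∀ x, a ≤ T (fun _ => a) x := by
    intro x
    have h1 := integral_le_integral_of_smul_le hc hm hmeas h0 hl' x
    rw [hmass, mul_one] at h1
    have hinth : Integrable (fun z => h (x + z)) m :=
      Integrable.of_bound (C := l) (hmeas.comp
        (measurable_const.add measurable_id)).aestronglyMeasurable (ae_of_all _ fun z => by
          rw [Real.norm_of_nonneg (h0 _)]
          exact hl' _)
    have hinthc : Integrable (fun z => (h (x + z) - Real.exp a) / l) m :=
      (hinth.sub (integrable_const _)).div_const _
    have h2 : T (fun _ => a) x = a + ((∫ z, h (x + z) ∂m) - Real.exp a) / l := by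
      simp only [T]
      rw [integral_add (integrable_const _) hinthc, integral_div, integral_sub hinth
        (integrable_const _)]
      simp
    rw [h2]
    have : 0 ≤ ((∫ z, h (x + z) ∂m) - Real.exp a) / l := div_nonneg (by linarith) hl.le
    linarith
  have hTb : ∀ u : Torus d → ℝ, Measurable u → (∀ x, u x ∈ Icc a b) → ∀ x, T u x ∈ Icc a b := by
    intro u hu hub x
    refine ⟨(hTa x).trans (hTmono _ _ measurable_const hu (fun _ => ⟨le_rfl, hab⟩) hub
      (fun y => (hub y).1) x), ?_⟩
    have h1 := integral_mono (hint u hu hub x) (integrable_const b)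
      fun z => hPhib _ (hh _) _ (hub _)
    simpa using h1
  let w : ℕ → Torus d → ℝ := fun n => T^[n] fun _ => a
  have hw1 : ∀ n, w (n + 1) = T (w n) := fun n => Function.iterate_succ_apply' T n _
  have hwm : ∀ n, Measurable (w n) ∧ ∀ x, w n x ∈ Icc a b := by
    intro n
    induction n with
    | zero => exact ⟨measurable_const, fun _ => ⟨le_rfl, hab⟩⟩
    | succ n ih =>
      rw [hw1]
      exact ⟨hTmeas _ ih.1, hTb _ ih.1 ih.2⟩
  have hwmono : Monotone w := by
    refine monotone_nat_of_le_succ fun n => ?_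
    induction n with
    | zero => exact fun x => ((hwm 1).2 x).1
    | succ n ih =>
      rw [hw1 n, hw1 (n + 1)]
      exact hTmono _ _ (hwm n).1 (hwm (n + 1)).1 (hwm n).2 (hwm (n + 1)).2 ih
  let u : Torus d → ℝ := fun x => ⨆ n, w n x
  have hlim : ∀ x, Tendsto (fun n => w n x) atTop (𝓝 (u x)) := fun x =>
    tendsto_atTop_ciSup (fun i j hij => hwmono hij x)
      ⟨b, by rintro _ ⟨n, rfl⟩; exact ((hwm n).2 x).2⟩
  have hum : Measurable u := measurable_of_tendsto_metrizable (fun n => (hwm n).1)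
    (tendsto_pi_nhds.2 hlim)
  have hub : ∀ x, u x ∈ Icc a b := fun x =>
    isClosed_Icc.mem_of_tendsto (hlim x) (Eventually.of_forall fun n => (hwm n).2 x)
  refine ⟨u, hum, ⟨max |a| |b|, fun x => abs_le_max_abs_abs (hub x).1 (hub x).2⟩, fun x => ?_⟩
  have h1 : Tendsto (fun n => T (w n) x) atTop (𝓝 (T u x)) := by
    refine tendsto_integral_of_dominated_convergence (fun _ => B)
      (fun n => (hint _ (hwm n).1 (hwm n).2 x).aestronglyMeasurable) (integrable_const _)
      (fun n => ae_of_all _ fun z => hbound _ (hh _) _ ((hwm n).2 _)) (ae_of_all _ fun z => ?_)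
    have h2 := hlim (x + z)
    exact h2.add ((tendsto_const_nhds.sub ((Real.continuous_exp.tendsto _).comp h2)).div_const l)
  refine tendsto_nhds_unique ((tendsto_add_atTop_iff_nat 1).2 (hlim x)) ?_
  simpa only [hw1] using h1

/-- The eigenvalues of `-Δ` on the torus. -/
def torusEigenvalue {d : ℕ} (k : Fin d → ℤ) : ℝ := 4 * Real.pi ^ 2 * ∑ i, (k i : ℝ) ^ 2

lemma torusEigenvalue_nonneg {d : ℕ} (k : Fin d → ℤ) : 0 ≤ torusEigenvalue k := by
  unfold torusEigenvalue
  positivity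

lemma memLp_ofReal_of_ae_bound {d : ℕ} {u : Torus d → ℝ} (hu : Measurable u) {A : ℝ}
    (hA : ∀ᵐ x ∂torusHaar d, |u x| ≤ A) : MemLp (fun x => (u x : ℂ)) 2 (torusHaar d) := by
  refine MemLp.of_bound (Complex.measurable_ofReal.comp hu).aestronglyMeasurable A ?_
  filter_upwards [hA] with x hx
  rwa [Complex.norm_real]

lemma integrable_conj_mFourier_mul {d : ℕ} {f : Torus d → ℂ} (hf : MemLp f 2 (torusHaar d))
    (k : Fin d → ℤ) :
    Integrable (fun x => conj (UnitAddTorus.mFourier k x) * f x) (torusHaar d) := by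
  refine (hf.integrable one_le_two).bdd_mul (c := 1)
    (Complex.continuous_conj.comp (UnitAddTorus.mFourier k).continuous).aestronglyMeasurable
    (ae_of_all _ fun x => ?_)
  rw [RCLike.norm_conj, norm_mFourier_apply]

lemma torusCoeff_sub {d : ℕ} {f g : Torus d → ℂ} (hf : MemLp f 2 (torusHaar d))
    (hg : MemLp g 2 (torusHaar d)) (k : Fin d → ℤ) :
    torusCoeff (fun x => f x - g x) k = torusCoeff f k - torusCoeff g k := by
  simp only [torusCoeff, mul_sub]
  exact integral_sub (integrable_conj_mFourier_mul hf k) (integrable_conj_mFourier_mul hg k)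

lemma exists_bounded_torusCoeff_solution {d : ℕ} {h : Torus d → ℝ} (hmeas : Measurable h) {M : ℝ}
    (h0 : ∀ x, 0 ≤ h x) (hM : ∀ x, h x ≤ M) (hmass : ∫ x, h x ∂torusHaar d = 1) :
    ∃ u : Torus d → ℝ, Measurable u ∧ (∃ A, ∀ x, |u x| ≤ A) ∧
      ∀ k, (torusEigenvalue k : ℂ) * torusCoeff (fun x => (u x : ℂ)) k =
        -torusCoeff (fun x => ((Real.exp (u x) - h x : ℝ) : ℂ)) k := by
  have hl : 0 < max M 1 := lt_max_of_lt_right one_pos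
  set l := max M 1
  have := isProbabilityMeasure_resolventMeasure d hl
  obtain ⟨c, hc, hcm⟩ := exists_smul_torusHaar_le_resolventMeasure d hl
  obtain ⟨u, hu, ⟨A, hA⟩, hfix⟩ := exists_bounded_resolvent_solution (resolventMeasure d l) hc hl hcm
    hmeas h0 (fun x => (hM x).trans (le_max_left _ _)) hmass
  refine ⟨u, hu, ⟨A, hA⟩, fun k => ?_⟩
  have hFm : Measurable fun x => Real.exp (u x) - h x := by fun_prop
  have hFb : ∀ x, |Real.exp (u x) - h x| ≤ max (Real.exp A) M := by
    intro x
    have h1 := Real.exp_le_exp.2 ((le_abs_self _).trans (hA x))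
    have h2 := Real.exp_pos (u x)
    have h3 := h0 x
    have h4 := hM x
    rw [abs_le]
    constructor
    · linarith [le_max_right (Real.exp A) M]
    · linarith [le_max_left (Real.exp A) M]
  have hu2 := memLp_ofReal_of_ae_bound hu (ae_of_all _ hA)
  have hF2 := memLp_ofReal_of_ae_bound hFm (ae_of_all _ hFb)
  let g : Torus d → ℂ := fun x => (u x : ℂ) - ((Real.exp (u x) - h x : ℝ) : ℂ) / (l : ℂ)
  have hgm : Measurable g := by fun_prop
  have hgb : ∀ x, ‖g x‖ ≤ A + max (Real.exp A) M / l := by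
    intro x
    refine (norm_sub_le _ _).trans ?_
    rw [norm_div, Complex.norm_real, Complex.norm_real, Complex.norm_real, Real.norm_of_nonneg hl.le]
    exact add_le_add (hA x) (by gcongr; exact hFb x)
  have hg : torusCoeff g k = torusCoeff (fun x => (u x : ℂ)) k -
      torusCoeff (fun x => ((Real.exp (u x) - h x : ℝ) : ℂ)) k / l := by
    have h1 := torusCoeff_sub hu2 (hF2.mul_const (l : ℂ)⁻¹) k
    have h2 : torusCoeff (fun x => ((Real.exp (u x) - h x : ℝ) : ℂ) * (l : ℂ)⁻¹) k =
        torusCoeff (fun x => ((Real.exp (u x) - h x : ℝ) : ℂ)) k * (l : ℂ)⁻¹ := by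
      simp only [torusCoeff, ← mul_assoc]
      exact integral_mul_const _ _
    rw [h2] at h1
    exact h1
  have hconv : (fun x => (u x : ℂ)) = fun x => ∫ z, g (x + z) ∂resolventMeasure d l := by
    funext x
    rw [hfix x, ← integral_complex_ofReal]
    refine integral_congr_ae (ae_of_all _ fun z => ?_)
    simp only [g]
    push_cast
    ring
  have hmain := torusCoeff_integral_add (resolventMeasure d l) hgm hgb k
  rw [← hconv, integral_mFourier_resolventMeasure d hl k, hg] at hmain
  have hne : (l : ℂ) + (torusEigenvalue k : ℂ) ≠ 0 := by
    rw [← Complex.ofReal_add, Complex.ofReal_ne_zero]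
    have := torusEigenvalue_nonneg k
    positivity
  have hl0 : (l : ℂ) ≠ 0 := Complex.ofReal_ne_zero.2 hl.ne'
  have hcast : ((l / (l + 4 * Real.pi ^ 2 * ∑ i, (k i : ℝ) ^ 2) : ℝ) : ℂ) =
      l / (l + (torusEigenvalue k : ℂ)) := by
    rw [torusEigenvalue]
    push_cast
    rfl
  rw [hcast] at hmain
  field_simp at hmain
  linear_combination hmain

lemma projT_repT {d : ℕ} (y : Torus d) : projT d (repT d y) = y := by
  funext i
  exact (AddCircle.equivIco 1 0).symm_apply_apply (y i)

lemma repT_projT_apply {d : ℕ} (x : Fin d → ℝ) (i : Fin d) :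
    repT d (projT d x) i = Int.fract (x i) := by
  have h1 := AddCircle.coe_equivIco_mk_apply (p := (1 : ℝ)) (x i)
  rwa [div_one, mul_one] at h1

lemma repT_mem_Cube {d : ℕ} (y : Torus d) : repT d y ∈ Cube d := by
  intro i _
  have h1 := (AddCircle.equivIco 1 0 (y i)).2
  exact ⟨h1.1, h1.2.trans_eq (zero_add 1)⟩

lemma repT_projT_of_mem_Cube {d : ℕ} {x : Fin d → ℝ} (hx : x ∈ Cube d) :
    repT d (projT d x) = x := by
  funext i
  rw [repT_projT_apply, Int.fract_eq_self]
  exact hx i (mem_univ i)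

lemma ZPeriodic.apply_repT_projT {d : ℕ} {E : Type*} {F : (Fin d → ℝ) → E} (hF : ZPeriodic F)
    (x : Fin d → ℝ) : F (repT d (projT d x)) = F x := by
  rw [← hF (repT d (projT d x)) fun i => ⌊x i⌋]
  congr 1
  funext i
  rw [Pi.add_apply, repT_projT_apply]
  exact Int.fract_add_floor (x i)

lemma projT_add_intCast {d : ℕ} (x : Fin d → ℝ) (k : Fin d → ℤ) :
    projT d (x + fun i => (k i : ℝ)) = projT d x := by
  funext i
  simp [projT]

lemma zPeriodic_comp_projT {d : ℕ} {E : Type*} (F : Torus d → E) :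
    ZPeriodic fun x => F (projT d x) := fun x k => by
  simp only [projT_add_intCast]

lemma measurable_repT (d : ℕ) : Measurable (repT d) :=
  measurable_pi_lambda _ fun i => measurable_subtype_coe.comp
    ((AddCircle.measurableEquivIco 1 0).measurable.comp (measurable_pi_apply i))

lemma measurableSet_Cube (d : ℕ) : MeasurableSet (Cube d) :=
  MeasurableSet.univ_pi fun _ => measurableSet_Ico

lemma measurePreserving_repT (d : ℕ) :
    MeasurePreserving (repT d) (torusHaar d) ((volume : Measure (Fin d → ℝ)).restrict (Cube d)) := by
  refine ⟨measurable_repT d, ?_⟩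
  rw [← (measurePreserving_projT d).map_eq, Measure.map_map (measurable_repT d) (measurable_projT d)]
  have h1 : repT d ∘ projT d =ᵐ[(volume : Measure (Fin d → ℝ)).restrict (Cube d)] id :=
    (ae_restrict_iff' (measurableSet_Cube d)).2 (ae_of_all _ fun x hx => repT_projT_of_mem_Cube hx)
  rw [Measure.map_congr h1, Measure.map_id]

instance (d : ℕ) : IsProbabilityMeasure ((volume : Measure (Fin d → ℝ)).restrict (Cube d)) :=
  (measurePreserving_repT d).map_eq ▸
    Measure.isProbabilityMeasure_map (measurable_repT d).aemeasurable

lemma integral_comp_repT {d : ℕ} {E : Type*} [NormedAddCommGroup E] [NormedSpace ℝ E]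
    {F : (Fin d → ℝ) → E}
    (hF : AEStronglyMeasurable F ((volume : Measure (Fin d → ℝ)).restrict (Cube d))) :
    ∫ y, F (repT d y) ∂torusHaar d = ∫ x in Cube d, F x := by
  rw [← (measurePreserving_repT d).map_eq] at hF ⊢
  exact (integral_map (measurable_repT d).aemeasurable hF).symm

/-- A continuous periodic function is bounded. -/
lemma ZPeriodic.exists_bound {d : ℕ} {F : (Fin d → ℝ) → ℝ} (hF : ZPeriodic F)
    (hc : Continuous F) : ∃ C, ∀ x, |F x| ≤ C := by
  obtain ⟨C, hC⟩ := (isCompact_univ_pi fun _ : Fin d => isCompact_Icc (a := (0 : ℝ)) (b := 1))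
    |>.exists_bound_of_continuousOn hc.continuousOn
  refine ⟨C, fun x => ?_⟩
  rw [← hF.apply_repT_projT x]
  exact hC _ fun i hi => Ico_subset_Icc_self (repT_mem_Cube (projT d x) i hi)

lemma ZPeriodic.fderiv_apply {d : ℕ} {F : (Fin d → ℝ) → ℝ} (hF : ZPeriodic F) (v : Fin d → ℝ) :
    ZPeriodic fun x => fderiv ℝ F x v := by
  intro x k
  have h1 : (fun y => F (y + fun i => (k i : ℝ))) = F := funext fun y => hF y k
  simp only
  rw [← fderiv_comp_add_right, h1]

lemma continuous_fderiv_apply_const {d : ℕ} {F : (Fin d → ℝ) → ℝ} (hF : ContDiff ℝ (⊤ : ℕ∞) F)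
    (v : Fin d → ℝ) : Continuous fun x => fderiv ℝ F x v :=
  (hF.continuous_fderiv (by simp)).clm_apply continuous_const

lemma memLp_of_continuous_zPeriodic {d : ℕ} {F : (Fin d → ℝ) → ℝ} (hF : ZPeriodic F)
    (hc : Continuous F) (p : ℝ≥0∞) :
    MemLp F p ((volume : Measure (Fin d → ℝ)).restrict (Cube d)) := by
  obtain ⟨C, hC⟩ := hF.exists_bound hc
  exact MemLp.of_bound hc.aestronglyMeasurable C (ae_of_all _ hC)

lemma setIntegral_Cube_add_right {d : ℕ} {F : (Fin d → ℝ) → ℝ} (hF : ZPeriodic F)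
    (hc : Continuous F) (v : Fin d → ℝ) :
    ∫ x in Cube d, F (x + v) = ∫ x in Cube d, F x := by
  have hper : ∀ y, F (repT d y + v) = F (repT d (y + projT d v)) := by
    intro y
    rw [← hF.apply_repT_projT (repT d y + v)]
    congr 2
    conv_rhs => rw [← projT_repT y]
    rfl
  rw [← integral_comp_repT hc.aestronglyMeasurable,
    ← integral_comp_repT (F := fun x => F (x + v)) (by fun_prop)]
  simp_rw [hper]
  exact integral_add_right_eq_self (μ := torusHaar d) (fun y => F (repT d y)) (projT d v)

lemma setIntegral_Cube_fderiv_eq_zero {d : ℕ} {F : (Fin d → ℝ) → ℝ} (hF : ZPeriodic F)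
    (hs : ContDiff ℝ (⊤ : ℕ∞) F) (v : Fin d → ℝ) : ∫ x in Cube d, fderiv ℝ F x v = 0 := by
  have hc := continuous_fderiv_apply_const hs v
  obtain ⟨C, hC⟩ := (hF.fderiv_apply v).exists_bound hc
  have hdiff : ∀ (x : Fin d → ℝ) (t : ℝ),
      HasDerivAt (fun s : ℝ => F (x + s • v)) (fderiv ℝ F (x + t • v) v) t := by
    intro x t
    have h1 := (hs.differentiable (by simp) (x + t • v)).hasFDerivAt
    have h2 : HasDerivAt (fun s : ℝ => x + s • v) v t := by
      simpa using ((hasDerivAt_id t).smul_const v).const_add x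
    exact h1.comp_hasDerivAt t h2
  have hF0 : Continuous F := hs.continuous
  have hmain := (hasDerivAt_integral_of_dominated_loc_of_deriv_le
    (μ := (volume : Measure (Fin d → ℝ)).restrict (Cube d)) (x₀ := (0 : ℝ)) (s := univ)
    (F := fun s x => F (x + s • v)) (F' := fun s x => fderiv ℝ F (x + s • v) v)
    (bound := fun _ => C) univ_mem
    (Eventually.of_forall fun s => (by fun_prop : Continuous fun x => F (x + s • v)).aestronglyMeasurable)
    (by simpa using (memLp_of_continuous_zPeriodic hF hF0 1).integrable le_rfl)
    (by simpa using hc.aestronglyMeasurable)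
    (ae_of_all _ fun x s _ => hC _) (integrable_const _)
    (ae_of_all _ fun x s _ => hdiff x s)).2
  simp only [setIntegral_Cube_add_right hF hF0, zero_smul, add_zero] at hmain
  exact hmain.unique (hasDerivAt_const _ _)

lemma setIntegral_Cube_mul_fderiv {d : ℕ} {F G : (Fin d → ℝ) → ℝ} (hF : ZPeriodic F)
    (hFs : ContDiff ℝ (⊤ : ℕ∞) F) (hG : ZPeriodic G) (hGs : ContDiff ℝ (⊤ : ℕ∞) G)
    (v : Fin d → ℝ) :
    ∫ x in Cube d, F x * fderiv ℝ G x v = -∫ x in Cube d, fderiv ℝ F x v * G x := by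
  have hper : ZPeriodic fun x => F x * G x := fun x k => by simp only [hF x k, hG x k]
  have h1 := setIntegral_Cube_fderiv_eq_zero hper (hFs.mul hGs) v
  have h2 : ∀ x, fderiv ℝ (fun x => F x * G x) x v = F x * fderiv ℝ G x v + fderiv ℝ F x v * G x := by
    intro x
    rw [fderiv_fun_mul (hFs.differentiable (by simp) x) (hGs.differentiable (by simp) x)]
    simp [mul_comm]
  have hi1 := (memLp_of_continuous_zPeriodic hF hFs.continuous 2).integrable_mul
    (memLp_of_continuous_zPeriodic (hG.fderiv_apply v) (continuous_fderiv_apply_const hGs v) 2)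
  have hi2 := (memLp_of_continuous_zPeriodic (hF.fderiv_apply v)
    (continuous_fderiv_apply_const hFs v) 2).integrable_mul
    (memLp_of_continuous_zPeriodic hG hGs.continuous 2)
  simp_rw [h2] at h1
  have h3 := integral_add hi1 hi2
  simp only [Pi.mul_apply] at h3
  rw [h3] at h1
  linarith

/-- The phase `2π k · x` of the Fourier mode `k`. -/
def torusPhase {d : ℕ} (k : Fin d → ℤ) (x : Fin d → ℝ) : ℝ := 2 * Real.pi * ∑ i, k i * x i

lemma contDiff_torusPhase {d : ℕ} (k : Fin d → ℤ) : ContDiff ℝ (⊤ : ℕ∞) (torusPhase k) := by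
  unfold torusPhase
  fun_prop

lemma fderiv_torusPhase_single {d : ℕ} (k : Fin d → ℤ) (x : Fin d → ℝ) (i : Fin d) :
    fderiv ℝ (torusPhase k) x (Pi.single i 1) = 2 * Real.pi * k i := by
  let L : (Fin d → ℝ) →L[ℝ] ℝ :=
    (2 * Real.pi) • ∑ j, (k j : ℝ) • ContinuousLinearMap.proj (R := ℝ) (φ := fun _ : Fin d => ℝ) j
  have h1 : torusPhase k = L := by
    funext y
    simp [torusPhase, L]
  rw [h1, L.fderiv]
  simp [L, Pi.single_apply]

lemma torusPhase_add_intCast {d : ℕ} (k : Fin d → ℤ) (x : Fin d → ℝ) (n : Fin d → ℤ) :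
    torusPhase k (x + fun i => (n i : ℝ)) = torusPhase k x + (∑ i, k i * n i : ℤ) * (2 * Real.pi) := by
  simp only [torusPhase, Pi.add_apply, mul_add, Finset.sum_add_distrib]
  push_cast
  ring

lemma zPeriodic_cos_torusPhase {d : ℕ} (k : Fin d → ℤ) :
    ZPeriodic fun x => Real.cos (torusPhase k x) := fun x n => by
  simp only [torusPhase_add_intCast, Real.cos_add_int_mul_two_pi]

lemma zPeriodic_sin_torusPhase {d : ℕ} (k : Fin d → ℤ) :
    ZPeriodic fun x => Real.sin (torusPhase k x) := fun x n => by
  simp only [torusPhase_add_intCast, Real.sin_add_int_mul_two_pi]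

lemma fderiv_cos_torusPhase {d : ℕ} (k : Fin d → ℤ) (x : Fin d → ℝ) (i : Fin d) :
    fderiv ℝ (fun y => Real.cos (torusPhase k y)) x (Pi.single i 1) =
      -(2 * Real.pi * k i) * Real.sin (torusPhase k x) := by
  rw [fderiv_cos ((contDiff_torusPhase k).differentiable (by simp) x)]
  simp [fderiv_torusPhase_single]
  ring

lemma fderiv_sin_torusPhase {d : ℕ} (k : Fin d → ℤ) (x : Fin d → ℝ) (i : Fin d) :
    fderiv ℝ (fun y => Real.sin (torusPhase k y)) x (Pi.single i 1) =
      2 * Real.pi * k i * Real.cos (torusPhase k x) := by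
  rw [fderiv_sin ((contDiff_torusPhase k).differentiable (by simp) x)]
  simp [fderiv_torusPhase_single]
  ring

lemma conj_mFourier_projT {d : ℕ} (k : Fin d → ℤ) (x : Fin d → ℝ) :
    conj (UnitAddTorus.mFourier k (projT d x)) =
      (Real.cos (torusPhase k x) : ℂ) - Real.sin (torusPhase k x) * Complex.I := by
  have h1 : UnitAddTorus.mFourier k (projT d x) = Complex.exp ((torusPhase k x : ℝ) * Complex.I) := by
    simp only [UnitAddTorus.mFourier, projT, ContinuousMap.coe_mk, fourier_coe_apply,
      ← Complex.exp_sum, torusPhase]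
    congr 1
    push_cast
    rw [Finset.mul_sum, Finset.sum_mul]
    refine Finset.sum_congr rfl fun i _ => ?_
    ring
  rw [h1, Complex.exp_mul_I, map_add, map_mul, Complex.conj_I, ← Complex.ofReal_cos,
    ← Complex.ofReal_sin, Complex.conj_ofReal, Complex.conj_ofReal]
  ring

/-- The Fourier coefficients of a real function on the unit cube. -/
def cubeCoeff {d : ℕ} (f : (Fin d → ℝ) → ℝ) : (Fin d → ℤ) → ℂ :=
  torusCoeff fun y => (f (repT d y) : ℂ)

lemma memLp_ofReal_comp_repT {d : ℕ} {f : (Fin d → ℝ) → ℝ}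
    (hf : MemLp f 2 ((volume : Measure (Fin d → ℝ)).restrict (Cube d))) :
    MemLp (fun y => (f (repT d y) : ℂ)) 2 (torusHaar d) :=
  (hf.comp_measurePreserving (measurePreserving_repT d)).ofReal

lemma integrable_mul_of_zPeriodic {d : ℕ} {f F : (Fin d → ℝ) → ℝ}
    (hf : MemLp f 2 ((volume : Measure (Fin d → ℝ)).restrict (Cube d)))
    (hF : ZPeriodic F) (hc : Continuous F) : IntegrableOn (fun x => f x * F x) (Cube d) :=
  hf.integrable_mul (memLp_of_continuous_zPeriodic hF hc 2)

lemma cubeCoeff_eq {d : ℕ} {f : (Fin d → ℝ) → ℝ}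
    (hf : MemLp f 2 ((volume : Measure (Fin d → ℝ)).restrict (Cube d))) (k : Fin d → ℤ) :
    cubeCoeff f k = ((∫ x in Cube d, f x * Real.cos (torusPhase k x) : ℝ) : ℂ) -
      (∫ x in Cube d, f x * Real.sin (torusPhase k x) : ℝ) * Complex.I := by
  have hcos := integrable_mul_of_zPeriodic hf (zPeriodic_cos_torusPhase k)
    (Real.continuous_cos.comp (contDiff_torusPhase k).continuous)
  have hsin := integrable_mul_of_zPeriodic hf (zPeriodic_sin_torusPhase k)
    (Real.continuous_sin.comp (contDiff_torusPhase k).continuous)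
  have h1 : ∀ y : Torus d, conj (UnitAddTorus.mFourier k y) * (f (repT d y) : ℂ) =
      ((f (repT d y) * Real.cos (torusPhase k (repT d y)) : ℝ) : ℂ) -
        (f (repT d y) * Real.sin (torusPhase k (repT d y)) : ℝ) * Complex.I := by
    intro y
    have h2 := conj_mFourier_projT k (repT d y)
    rw [projT_repT] at h2
    rw [h2]
    push_cast
    ring
  have hi := hcos.ofReal (𝕜 := ℂ)
  have hj := (hsin.ofReal (𝕜 := ℂ)).mul_const Complex.I
  simp only [cubeCoeff, torusCoeff]
  simp_rw [h1]
  rw [integral_comp_repT (F := fun x => ((f x * Real.cos (torusPhase k x) : ℝ) : ℂ) -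
    (f x * Real.sin (torusPhase k x) : ℝ) * Complex.I) (hi.sub hj).aestronglyMeasurable]
  refine (integral_sub hi hj).trans ?_
  rw [integral_mul_const]
  exact congrArg₂ (fun a b => a - b * Complex.I) integral_ofReal integral_ofReal

/-- The Fourier coefficients of a weak partial derivative. -/
lemma cubeCoeff_of_weak_partial {d : ℕ} {f g : (Fin d → ℝ) → ℝ}
    (hf : MemLp f 2 ((volume : Measure (Fin d → ℝ)).restrict (Cube d)))
    (hg : MemLp g 2 ((volume : Measure (Fin d → ℝ)).restrict (Cube d))) (i : Fin d)
    (hfg : ∀ φ : (Fin d → ℝ) → ℝ, ContDiff ℝ (⊤ : ℕ∞) φ → ZPeriodic φ →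
      ∫ x in Cube d, f x * fderiv ℝ φ x (Pi.single i 1) = -∫ x in Cube d, g x * φ x)
    (k : Fin d → ℤ) :
    cubeCoeff g k = 2 * Real.pi * k i * Complex.I * cubeCoeff f k := by
  have hcos := hfg _ (contDiff_torusPhase k).cos (zPeriodic_cos_torusPhase k)
  have hsin := hfg _ (contDiff_torusPhase k).sin (zPeriodic_sin_torusPhase k)
  simp only [fderiv_cos_torusPhase, fderiv_sin_torusPhase, mul_left_comm (f _),
    integral_const_mul] at hcos hsin
  have hcos' : ∫ x in Cube d, g x * Real.cos (torusPhase k x) =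
      2 * Real.pi * k i * ∫ x in Cube d, f x * Real.sin (torusPhase k x) := by linarith
  have hsin' : ∫ x in Cube d, g x * Real.sin (torusPhase k x) =
      -(2 * Real.pi * k i * ∫ x in Cube d, f x * Real.cos (torusPhase k x)) := by linarith
  rw [cubeCoeff_eq hf, cubeCoeff_eq hg, hcos', hsin']
  push_cast
  linear_combination (2 * Real.pi * k i *
    (∫ x in Cube d, f x * Real.sin (torusPhase k x) : ℝ) : ℂ) * Complex.I_mul_I

/-- The Fourier coefficients of a weak divergence. -/
lemma cubeCoeff_of_weak_divergence {d : ℕ} {F : (Fin d → ℝ) → ℝ} {V : (Fin d → ℝ) → Fin d → ℝ}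
    (hF : MemLp F 2 ((volume : Measure (Fin d → ℝ)).restrict (Cube d)))
    (hV : ∀ i, MemLp (fun x => V x i) 2 ((volume : Measure (Fin d → ℝ)).restrict (Cube d)))
    (hFV : ∀ φ : (Fin d → ℝ) → ℝ, ContDiff ℝ (⊤ : ℕ∞) φ → ZPeriodic φ →
      -∫ x in Cube d, ∑ i, V x i * fderiv ℝ φ x (Pi.single i 1) = ∫ x in Cube d, F x * φ x)
    (k : Fin d → ℤ) :
    cubeCoeff F k = ∑ i, 2 * Real.pi * k i * Complex.I * cubeCoeff (fun x => V x i) k := by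
  have hsplit : ∀ φ : (Fin d → ℝ) → ℝ, ContDiff ℝ (⊤ : ℕ∞) φ → ZPeriodic φ →
      ∫ x in Cube d, F x * φ x =
        -∑ i, ∫ x in Cube d, V x i * fderiv ℝ φ x (Pi.single i 1) := by
    intro φ hφ hper
    rw [← hFV φ hφ hper, integral_finsetSum _ fun i _ => integrable_mul_of_zPeriodic (hV i)
      (hper.fderiv_apply _) (continuous_fderiv_apply_const hφ _)]
  have hcos := hsplit _ (contDiff_torusPhase k).cos (zPeriodic_cos_torusPhase k)
  have hsin := hsplit _ (contDiff_torusPhase k).sin (zPeriodic_sin_torusPhase k)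
  simp only [fderiv_cos_torusPhase, fderiv_sin_torusPhase, mul_left_comm (V _ _),
    integral_const_mul] at hcos hsin
  rw [cubeCoeff_eq hF, hcos, hsin]
  simp_rw [cubeCoeff_eq (hV _)]
  push_cast
  rw [← Finset.sum_neg_distrib, ← Finset.sum_neg_distrib, Finset.sum_mul, ← Finset.sum_sub_distrib]
  refine Finset.sum_congr rfl fun i _ => ?_
  linear_combination (2 * Real.pi * k i *
    (∫ x in Cube d, V x i * Real.sin (torusPhase k x) : ℝ) : ℂ) * Complex.I_mul_I

lemma cubeCoeff_fderiv {d : ℕ} {φ : (Fin d → ℝ) → ℝ} (hφ : ContDiff ℝ (⊤ : ℕ∞) φ)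
    (hper : ZPeriodic φ) (i : Fin d) (k : Fin d → ℤ) :
    cubeCoeff (fun x => fderiv ℝ φ x (Pi.single i 1)) k =
      2 * Real.pi * k i * Complex.I * cubeCoeff φ k :=
  cubeCoeff_of_weak_partial (memLp_of_continuous_zPeriodic hper hφ.continuous 2)
    (memLp_of_continuous_zPeriodic (hper.fderiv_apply _) (continuous_fderiv_apply_const hφ _) 2) i
    (fun _ hψ hψper => setIntegral_Cube_mul_fderiv hper hφ hψper hψ _) k

lemma memLp_exp_sub {d : ℕ} {U h : (Fin d → ℝ) → ℝ} (hU : Measurable U) (hh : Measurable h)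
    {A M : ℝ} (hA : ∀ᵐ x ∂((volume : Measure (Fin d → ℝ)).restrict (Cube d)), |U x| ≤ A)
    (hM : ∀ᵐ x ∂((volume : Measure (Fin d → ℝ)).restrict (Cube d)), |h x| ≤ M) :
    MemLp (fun x => Real.exp (U x) - h x) 2 ((volume : Measure (Fin d → ℝ)).restrict (Cube d)) := by
  refine MemLp.of_bound (by fun_prop) (Real.exp A + M) ?_
  filter_upwards [hA, hM] with x hx hx'
  refine (norm_sub_le _ _).trans (add_le_add ?_ hx')
  rw [Real.norm_of_nonneg (Real.exp_pos _).le]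
  exact Real.exp_le_exp.2 ((le_abs_self _).trans hx)

lemma IsH1LinfPBSol.memLp {d : ℕ} {h U : (Fin d → ℝ) → ℝ} {V : (Fin d → ℝ) → Fin d → ℝ}
    (hs : IsH1LinfPBSol d h U V) :
    MemLp U 2 ((volume : Measure (Fin d → ℝ)).restrict (Cube d)) :=
  (memLp_two_iff_integrable_sq hs.meas.aestronglyMeasurable).2 hs.memL2

lemma IsH1LinfPBSol.memLp_grad {d : ℕ} {h U : (Fin d → ℝ) → ℝ} {V : (Fin d → ℝ) → Fin d → ℝ}
    (hs : IsH1LinfPBSol d h U V) (i : Fin d) :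
    MemLp (fun x => V x i) 2 ((volume : Measure (Fin d → ℝ)).restrict (Cube d)) := by
  have hm : Measurable fun x => V x i := (measurable_pi_apply i).comp hs.gradMeas
  refine (memLp_two_iff_integrable_sq hm.aestronglyMeasurable).2 ?_
  refine Integrable.mono' hs.gradMemL2 (hm.pow_const 2).aestronglyMeasurable (ae_of_all _ fun x => ?_)
  rw [Real.norm_of_nonneg (sq_nonneg _)]
  exact Finset.single_le_sum (f := fun i => V x i ^ 2) (fun j _ => sq_nonneg _) (Finset.mem_univ i)

lemma sum_mul_I_mul_mul_I {d : ℕ} (k : Fin d → ℤ) (z : ℂ) :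
    ∑ i, 2 * Real.pi * k i * Complex.I * (2 * Real.pi * k i * Complex.I * z) =
      -((torusEigenvalue k : ℂ) * z) := by
  rw [torusEigenvalue]
  push_cast
  rw [Finset.mul_sum, Finset.sum_mul, ← Finset.sum_neg_distrib]
  refine Finset.sum_congr rfl fun i _ => ?_
  linear_combination (2 * Real.pi * k i) ^ 2 * z * Complex.I_mul_I

lemma IsH1LinfPBSol.torusEigenvalue_mul_cubeCoeff {d : ℕ} {h U : (Fin d → ℝ) → ℝ}
    {V : (Fin d → ℝ) → Fin d → ℝ} (hs : IsH1LinfPBSol d h U V) (hh : Measurable h) {M : ℝ}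
    (hM : ∀ᵐ x ∂((volume : Measure (Fin d → ℝ)).restrict (Cube d)), |h x| ≤ M) (k : Fin d → ℤ) :
    (torusEigenvalue k : ℂ) * cubeCoeff U k = -cubeCoeff (fun x => Real.exp (U x) - h x) k := by
  obtain ⟨A, hA⟩ := hs.bdd
  rw [cubeCoeff_of_weak_divergence (memLp_exp_sub hs.meas hh hA hM) hs.memLp_grad hs.weakEq]
  simp_rw [cubeCoeff_of_weak_partial hs.memLp (hs.memLp_grad _) _
    (fun φ hφ hper => hs.weakGrad φ hφ hper _), sum_mul_I_mul_mul_I, neg_neg]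

lemma cubeCoeff_sub {d : ℕ} {f g : (Fin d → ℝ) → ℝ}
    (hf : MemLp f 2 ((volume : Measure (Fin d → ℝ)).restrict (Cube d)))
    (hg : MemLp g 2 ((volume : Measure (Fin d → ℝ)).restrict (Cube d))) (k : Fin d → ℤ) :
    cubeCoeff (fun x => f x - g x) k = cubeCoeff f k - cubeCoeff g k := by
  rw [cubeCoeff, cubeCoeff, cubeCoeff,
    ← torusCoeff_sub (memLp_ofReal_comp_repT hf) (memLp_ofReal_comp_repT hg)]
  simp only [Complex.ofReal_sub]

/-- Parseval's identity for the pairing of a complex function on the torus with a real one. -/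
lemma hasSum_re_conj_torusCoeff_mul_cubeCoeff {d : ℕ} {G : Torus d → ℂ}
    (hG : MemLp G 2 (torusHaar d)) {f : (Fin d → ℝ) → ℝ}
    (hf : MemLp f 2 ((volume : Measure (Fin d → ℝ)).restrict (Cube d))) :
    HasSum (fun k => (conj (torusCoeff G k) * cubeCoeff f k).re)
      (∫ x in Cube d, (G (projT d x)).re * f x) := by
  have h1 := Complex.hasSum_re (hasSum_conj_torusCoeff_mul hG (memLp_ofReal_comp_repT hf))
  have hint : Integrable (fun y => conj (G y) * (f (repT d y) : ℂ)) (torusHaar d) :=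
    hG.star.integrable_mul (memLp_ofReal_comp_repT hf)
  have h2 : (∫ y, conj (G y) * (f (repT d y) : ℂ) ∂torusHaar d).re =
      ∫ y, (G (projT d (repT d y))).re * f (repT d y) ∂torusHaar d := by
    refine (integral_re hint).symm.trans (integral_congr_ae (ae_of_all _ fun y => ?_))
    simp [projT_repT]
  have hGm : AEStronglyMeasurable (fun x => (G (projT d x)).re)
      ((volume : Measure (Fin d → ℝ)).restrict (Cube d)) :=
    Complex.continuous_re.comp_aestronglyMeasurable
      (hG.1.comp_measurePreserving (measurePreserving_projT d))
  rw [h2, integral_comp_repT (F := fun x => (G (projT d x)).re * f x) (hGm.mul hf.1)] at h1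
  exact h1

lemma hasSum_re_conj_cubeCoeff_mul {d : ℕ} {f g : (Fin d → ℝ) → ℝ}
    (hf : MemLp f 2 ((volume : Measure (Fin d → ℝ)).restrict (Cube d)))
    (hg : MemLp g 2 ((volume : Measure (Fin d → ℝ)).restrict (Cube d))) :
    HasSum (fun k => (conj (cubeCoeff f k) * cubeCoeff g k).re) (∫ x in Cube d, f x * g x) := by
  have h1 := hasSum_re_conj_torusCoeff_mul_cubeCoeff (memLp_ofReal_comp_repT hf) hg
  have h2 : ∫ x in Cube d, ((f (repT d (projT d x)) : ℂ)).re * g x = ∫ x in Cube d, f x * g x :=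
    setIntegral_congr_fun (measurableSet_Cube d) fun x hx => by
      simp only [repT_projT_of_mem_Cube hx, Complex.ofReal_re]
  rwa [h2] at h1

/-- Uniqueness for the Poisson–Boltzmann equation. -/
lemma IsH1LinfPBSol.ae_eq {d : ℕ} {h U U' : (Fin d → ℝ) → ℝ} {V V' : (Fin d → ℝ) → Fin d → ℝ}
    (hs' : IsH1LinfPBSol d h U' V') (hs : IsH1LinfPBSol d h U V) (hh : Measurable h) {M : ℝ}
    (hM : ∀ᵐ x ∂((volume : Measure (Fin d → ℝ)).restrict (Cube d)), |h x| ≤ M) :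
    U' =ᵐ[(volume : Measure (Fin d → ℝ)).restrict (Cube d)] U := by
  obtain ⟨A, hA⟩ := hs.bdd
  obtain ⟨A', hA'⟩ := hs'.bdd
  have hF := memLp_exp_sub hs.meas hh hA hM
  have hF' := memLp_exp_sub hs'.meas hh hA' hM
  have hW := hs'.memLp.sub hs.memLp
  have hG := hF'.sub hF
  have hcoeff : ∀ k, cubeCoeff (fun x => (Real.exp (U' x) - h x) - (Real.exp (U x) - h x)) k =
      -((torusEigenvalue k : ℂ) * cubeCoeff (fun x => U' x - U x) k) := by
    intro k
    rw [cubeCoeff_sub hF' hF, cubeCoeff_sub hs'.memLp hs.memLp]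
    linear_combination hs'.torusEigenvalue_mul_cubeCoeff hh hM k -
      hs.torusEigenvalue_mul_cubeCoeff hh hM k
  have hle : ∫ x in Cube d, (U' x - U x) * ((Real.exp (U' x) - h x) - (Real.exp (U x) - h x)) ≤ 0 := by
    refine (hasSum_re_conj_cubeCoeff_mul hW hG).nonpos fun k => ?_
    have h1 : conj (cubeCoeff (U' - U) k) * cubeCoeff
        ((fun x => Real.exp (U' x) - h x) - fun x => Real.exp (U x) - h x) k =
        ((-(torusEigenvalue k * ‖cubeCoeff (U' - U) k‖ ^ 2) : ℝ) : ℂ) := by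
      refine (congrArg _ (hcoeff k)).trans ?_
      push_cast
      rw [← Complex.conj_mul']
      change _ = -((torusEigenvalue k : ℂ) * (conj (cubeCoeff (fun x => U' x - U x) k) * _))
      change conj (cubeCoeff (fun x => U' x - U x) k) * _ = _
      ring_nf
      rfl
    rw [h1, Complex.ofReal_re]
    have h2 := torusEigenvalue_nonneg k
    rw [Left.neg_nonpos_iff]
    positivity
  have hnn : ∀ x, 0 ≤ (U' x - U x) * ((Real.exp (U' x) - h x) - (Real.exp (U x) - h x)) := by
    intro x
    rcases le_total (U x) (U' x) with hx | hx
    · exact mul_nonneg (by linarith) (by linarith [Real.exp_le_exp.2 hx])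
    · exact mul_nonneg_of_nonpos_of_nonpos (by linarith) (by linarith [Real.exp_le_exp.2 hx])
  have hzero := (integral_eq_zero_iff_of_nonneg hnn (hW.integrable_mul hG)).1
    (le_antisymm hle (integral_nonneg hnn))
  filter_upwards [hzero] with x hx
  rcases mul_eq_zero.1 hx with h1 | h1
  · linarith
  · exact Real.exp_injective (by linarith)

/-- Existence for the Poisson–Boltzmann equation, in terms of Fourier coefficients. -/
lemma exists_bounded_cubeCoeff_solution {d : ℕ} {h : (Fin d → ℝ) → ℝ} (hh : Measurable h) {M : ℝ}
    (hM : ∀ᵐ x ∂((volume : Measure (Fin d → ℝ)).restrict (Cube d)), |h x| ≤ M)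
    (hnn : ∀ᵐ x ∂((volume : Measure (Fin d → ℝ)).restrict (Cube d)), 0 ≤ h x)
    (hmass : ∫ x in Cube d, h x = 1) :
    ∃ u : Torus d → ℝ, Measurable u ∧ (∃ A, ∀ x, |u x| ≤ A) ∧
      ∀ k, (torusEigenvalue k : ℂ) * cubeCoeff (fun x => u (projT d x)) k =
        -cubeCoeff (fun x => Real.exp (u (projT d x)) - h x) k := by
  let h₁ : Torus d → ℝ := fun y => max 0 (min (h (repT d y)) (max M 0))
  have hm₁ : Measurable h₁ :=
    measurable_const.max ((hh.comp (measurable_repT d)).min measurable_const)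
  have hae : ∀ᵐ y ∂torusHaar d, h₁ y = h (repT d y) := by
    filter_upwards [(measurePreserving_repT d).quasiMeasurePreserving.ae hM,
      (measurePreserving_repT d).quasiMeasurePreserving.ae hnn] with y h1 h2
    simp only [h₁]
    rw [min_eq_left (((le_abs_self _).trans h1).trans (le_max_left _ _)), max_eq_right h2]
  have hmass₁ : ∫ y, h₁ y ∂torusHaar d = 1 := by
    rw [integral_congr_ae hae, integral_comp_repT hh.aestronglyMeasurable, hmass]
  obtain ⟨u, hu, hA, hk⟩ := exists_bounded_torusCoeff_solution hm₁ (M := max M 0)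
    (fun x => le_max_left _ _) (fun x => max_le (le_max_right _ _) (min_le_right _ _)) hmass₁
  refine ⟨u, hu, hA, fun k => ?_⟩
  simp only [cubeCoeff, projT_repT]
  rw [hk k]
  refine congrArg Neg.neg (congrFun (torusCoeff_congr_ae ?_) k)
  filter_upwards [hae] with y hy
  rw [hy]

lemma norm_mul_I_sq_le {d : ℕ} (k : Fin d → ℤ) (i : Fin d) {z w : ℂ}
    (hzw : (torusEigenvalue k : ℂ) * z = -w) :
    ‖2 * Real.pi * k i * Complex.I * z‖ ^ 2 ≤ ‖w‖ ^ 2 := by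
  have h1 : ‖w‖ = torusEigenvalue k * ‖z‖ := by
    rw [← norm_neg, ← hzw, norm_mul, Complex.norm_real, Real.norm_of_nonneg (torusEigenvalue_nonneg k)]
  have h2 : ‖2 * Real.pi * k i * Complex.I * z‖ = 2 * Real.pi * |(k i : ℝ)| * ‖z‖ := by
    simp [abs_of_pos Real.pi_pos]
  have h3 : |(k i : ℝ)| ≤ (k i : ℝ) ^ 2 := by
    rw [← sq_abs]
    rcases eq_or_ne (k i) 0 with h0 | h0
    · simp [h0]
    · have : (1 : ℝ) ≤ |(k i : ℝ)| := by exact_mod_cast Int.one_le_abs h0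
      nlinarith
  have h4 : (k i : ℝ) ^ 2 ≤ ∑ j, (k j : ℝ) ^ 2 :=
    Finset.single_le_sum (f := fun j => (k j : ℝ) ^ 2) (fun j _ => sq_nonneg _) (Finset.mem_univ i)
  have h5 : 2 * Real.pi ≤ 4 * Real.pi ^ 2 := by nlinarith [Real.pi_gt_three]
  rw [h1, h2, torusEigenvalue]
  gcongr
  exact h3.trans h4

lemma exists_isH1LinfPBSol {d : ℕ} {h : (Fin d → ℝ) → ℝ} (hh : Measurable h) {M : ℝ}
    (hM : ∀ᵐ x ∂((volume : Measure (Fin d → ℝ)).restrict (Cube d)), |h x| ≤ M)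
    (hnn : ∀ᵐ x ∂((volume : Measure (Fin d → ℝ)).restrict (Cube d)), 0 ≤ h x)
    (hmass : ∫ x in Cube d, h x = 1) :
    ∃ (U : (Fin d → ℝ) → ℝ) (V : (Fin d → ℝ) → Fin d → ℝ), IsH1LinfPBSol d h U V := by
  obtain ⟨u, hu, ⟨A, hA⟩, hk⟩ := exists_bounded_cubeCoeff_solution hh hM hnn hmass
  set U : (Fin d → ℝ) → ℝ := fun x => u (projT d x) with hU
  have hUm : Measurable U := hu.comp (measurable_projT d)
  have hUA : ∀ᵐ x ∂((volume : Measure (Fin d → ℝ)).restrict (Cube d)), |U x| ≤ A :=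
    ae_of_all _ fun x => hA _
  have hU2 : MemLp U 2 ((volume : Measure (Fin d → ℝ)).restrict (Cube d)) :=
    MemLp.of_bound hUm.aestronglyMeasurable A hUA
  have hF2 := memLp_exp_sub hUm hh hUA hM
  have hsum : ∀ i, Summable fun k : Fin d → ℤ =>
      ‖2 * Real.pi * k i * Complex.I * cubeCoeff U k‖ ^ 2 := fun i =>
    Summable.of_nonneg_of_le (fun k => sq_nonneg _) (fun k => norm_mul_I_sq_le k i (hk k))
      (summable_sq_norm_torusCoeff (memLp_ofReal_comp_repT hF2))
  choose G hGm hG2 hGk using fun i => exists_torusCoeff_eq _ (hsum i)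
  have hGre : ∀ i, MemLp (fun x => (G i (projT d x)).re) 2
      ((volume : Measure (Fin d → ℝ)).restrict (Cube d)) := fun i =>
    ((hG2 i).comp_measurePreserving (measurePreserving_projT d)).re
  refine ⟨U, fun x i => (G i (projT d x)).re, zPeriodic_comp_projT u,
    zPeriodic_comp_projT fun y i => (G i y).re, hUm, measurable_pi_lambda _ fun i =>
      Complex.measurable_re.comp ((hGm i).comp (measurable_projT d)), ⟨A, hUA⟩, hU2.integrable_sq,
    integrable_finsetSum _ fun i _ => (hGre i).integrable_sq, ?_, ?_⟩
  · intro φ hφ hper i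
    have h1 := hasSum_re_conj_cubeCoeff_mul hU2 (memLp_of_continuous_zPeriodic
      (hper.fderiv_apply (Pi.single i 1)) (continuous_fderiv_apply_const hφ _) 2)
    have h2 := (hasSum_re_conj_torusCoeff_mul_cubeCoeff (hG2 i)
      (memLp_of_continuous_zPeriodic hper hφ.continuous 2)).neg
    refine h1.unique (h2.congr_fun fun k => ?_)
    rw [cubeCoeff_fderiv hφ hper, hGk, ← Complex.neg_re]
    congr 1
    simp only [map_mul, Complex.conj_I, Complex.conj_ofReal, map_ofNat, map_intCast]
    ring
  · intro φ hφ hper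
    have h1 : HasSum (fun k => ∑ i, (conj (torusCoeff (G i) k) *
        cubeCoeff (fun x => fderiv ℝ φ x (Pi.single i 1)) k).re) _ :=
      hasSum_sum fun i _ => hasSum_re_conj_torusCoeff_mul_cubeCoeff (hG2 i)
        (memLp_of_continuous_zPeriodic (hper.fderiv_apply (Pi.single i 1))
          (continuous_fderiv_apply_const hφ _) 2)
    have h2 := hasSum_re_conj_cubeCoeff_mul hF2 (memLp_of_continuous_zPeriodic hper hφ.continuous 2)
    rw [integral_finsetSum _ fun i _ => integrable_mul_of_zPeriodic (hGre i)
      (hper.fderiv_apply _) (continuous_fderiv_apply_const hφ _)]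
    refine h1.neg.unique (h2.congr_fun fun k => ?_)
    have h3 : ∀ i, conj (torusCoeff (G i) k) *
        cubeCoeff (fun x => fderiv ℝ φ x (Pi.single i 1)) k =
        -(2 * Real.pi * k i * Complex.I * (2 * Real.pi * k i * Complex.I *
          (conj (cubeCoeff U k) * cubeCoeff φ k))) := by
      intro i
      rw [cubeCoeff_fderiv hφ hper, hGk]
      simp only [map_mul, Complex.conj_I, Complex.conj_ofReal, map_ofNat, map_intCast]
      ring
    have h4 := congrArg conj (hk k)
    rw [map_mul, map_neg, Complex.conj_ofReal] at h4
    rw [← Complex.re_sum, ← Complex.neg_re]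
    congr 1
    simp_rw [h3]
    rw [Finset.sum_neg_distrib, sum_mul_I_mul_mul_I]
    linear_combination (-cubeCoeff φ k) * h4

/-- **Solvability of the Poisson–Boltzmann equation on the torus.** -/
theorem poisson_boltzmann_solvable
    (d : ℕ) (hd : 1 ≤ d) (h : (Fin d → ℝ) → ℝ)
    (hper : ZPeriodic h) (hmeas : Measurable h)
    -- `h ∈ L^∞(𝕋^d)`, `h ≥ 0` a.e., `∫ h = 1`
    (hbdd : ∃ M : ℝ, ∀ᵐ x ∂((volume : Measure (Fin d → ℝ)).restrict (Cube d)),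
      |h x| ≤ M)
    (hnn : ∀ᵐ x ∂((volume : Measure (Fin d → ℝ)).restrict (Cube d)), 0 ≤ h x)
    (hmass : ∫ x in Cube d, h x = 1) :
    ∃ (U : (Fin d → ℝ) → ℝ) (V : (Fin d → ℝ) → Fin d → ℝ),
      IsH1LinfPBSol d h U V ∧
      ∀ (U' : (Fin d → ℝ) → ℝ) (V' : (Fin d → ℝ) → Fin d → ℝ),
        IsH1LinfPBSol d h U' V' →
        U' =ᵐ[(volume : Measure (Fin d → ℝ)).restrict (Cube d)] U := by
  obtain ⟨M, hM⟩ := hbdd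
  obtain ⟨U, V, hs⟩ := exists_isH1LinfPBSol hmeas hM hnn hmass
  exact ⟨U, V, hs, fun U' V' hs' => hs'.ae_eq hs hmeas hM⟩
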